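/- Let a, b be integers with a < 0 or b < 0, and set k = min(a,b). Then H^{m,n}(G_C(a,b)) = 0 whenever m < 0, and also whenever m = 0 and n > k−2; and for m = 0 and n ≤ k−2, H^{0,n}(G_C(a,b)) is a ℂ-vector space of dimension binom(2, a+b−n−2) (in particular zero unless 0 ≤ a+b−n−2 ≤ 2). -/

import Mathlib

/- Setup: `Ex = ⋀(ℂ⁴)` is the exterior algebra on generators `f 0, f 1, f 2, f 3`
(`f 0, f 1` the "plus" generators, `f 2, f 3` the "minus" generators); `lamPM k b`
is `Λ₊ᵏ∧Λ₋ᵇ` (zero for indices outside `{0,1,2}`).  `G_C = Ex ⊗ ℂ[u₁,u₂,v₁,v₂]`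
(variables `X 0, X 1 = u₁, u₂` and `X 2, X 3 = v₁, v₂`) with differential
`∇(ω⊗q) = (f₁∧ω)⊗u₁v₁q + (f₂∧ω)⊗u₂v₁q + (f₃∧ω)⊗u₁v₂q + (f₄∧ω)⊗u₂v₂q`.
`GC a b m n` is the bigraded piece `G_C(a,b)^{m,n}` spanned by the
`ω ⊗ q·v₁ʳv₂ˢ` with `ω ∈ Λ₊^{a+r}∧Λ₋^{b+s}`, `q` homogeneous of degree `−m` in
`u₁,u₂`, and `r+s = −n`. -/

set_option synthInstance.maxHeartbeats 1000000
set_option maxHeartbeats 1000000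

noncomputable section

open scoped TensorProduct

abbrev Ex : Type := ExteriorAlgebra ℂ (Fin 4 → ℂ)

def f (i : Fin 4) : Ex := ExteriorAlgebra.ι ℂ (Pi.single i 1)

/-- `Λ₊ᵏ∧Λ₋ᵇ` for integer indices (zero when `k < 0` or `b < 0`). -/
def lamPM (k b : ℤ) : Submodule ℂ Ex :=
  Submodule.span ℂ {x | ∃ lp lm : List (Fin 2), (lp.length : ℤ) = k ∧ (lm.length : ℤ) = b ∧
    x = (lp.map (fun i : Fin 2 => f ⟨i.1, by have := i.2; omega⟩)).prod *
        (lm.map (fun i : Fin 2 => f ⟨i.1 + 2, by have := i.2; omega⟩)).prod}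

abbrev P4 : Type := MvPolynomial (Fin 4) ℂ

abbrev MEx : Type := Ex ⊗[ℂ] P4

instance : AddCommGroup MEx := inferInstance
instance : Module ℂ MEx := inferInstance

/-- the inclusion of the `u`-variables -/
def uin : Fin 2 → Fin 4 := fun i => ⟨i.1, by have := i.2; omega⟩

/-- `∇(ω⊗q) = (f₁∧ω)⊗u₁v₁q + (f₂∧ω)⊗u₂v₁q + (f₃∧ω)⊗u₁v₂q + (f₄∧ω)⊗u₂v₂q` -/
def nabla : MEx →ₗ[ℂ] MEx :=
  TensorProduct.map (LinearMap.mulLeft ℂ (f 0)) (LinearMap.mulLeft ℂ (MvPolynomial.X 0 * MvPolynomial.X 2 : P4)) +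
  TensorProduct.map (LinearMap.mulLeft ℂ (f 1)) (LinearMap.mulLeft ℂ (MvPolynomial.X 1 * MvPolynomial.X 2 : P4)) +
  TensorProduct.map (LinearMap.mulLeft ℂ (f 2)) (LinearMap.mulLeft ℂ (MvPolynomial.X 0 * MvPolynomial.X 3 : P4)) +
  TensorProduct.map (LinearMap.mulLeft ℂ (f 3)) (LinearMap.mulLeft ℂ (MvPolynomial.X 1 * MvPolynomial.X 3 : P4))

/-- The bigraded piece `G_C(a,b)^{m,n}` (of `u`-degree `−m` and total `v`-degree `−n`). -/
def GC (a b m n : ℤ) : Submodule ℂ MEx :=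
  Submodule.span ℂ {z | ∃ (r s d : ℕ) (ω : Ex) (q : MvPolynomial (Fin 2) ℂ),
    ω ∈ lamPM (a + r) (b + s) ∧ q.IsHomogeneous d ∧ (d : ℤ) = -m ∧ ((r : ℤ) + s = -n) ∧
    z = ω ⊗ₜ (MvPolynomial.rename uin q * MvPolynomial.X 2 ^ r * MvPolynomial.X 3 ^ s)}

/-- `binom(2, n)` for an integer `n`, interpreted as `0` when `n < 0`. -/
def zbinom (n : ℤ) : ℕ := if 0 ≤ n then Nat.choose 2 n.toNat else 0

set_option linter.unusedSimpArgs false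
structure Sys {M : Type*} [AddCommGroup M] [Module ℂ M]
    (V D0 D1 E0 E1 U0 U1 P0 P1 : M →ₗ[ℂ] M) : Prop where
  D0E0 : ∀ z, D0 (E0 z) = V z - E0 (D0 z)
  D1E1 : ∀ z, D1 (E1 z) = V z - E1 (D1 z)
  D0E1 : ∀ z, D0 (E1 z) = - E1 (D0 z)
  D1E0 : ∀ z, D1 (E0 z) = - E0 (D1 z)
  D00 : ∀ z, D0 (D0 z) = 0
  D11 : ∀ z, D1 (D1 z) = 0
  D10 : ∀ z, D1 (D0 z) = - D0 (D1 z)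
  E00 : ∀ z, E0 (E0 z) = 0
  E11 : ∀ z, E1 (E1 z) = 0
  E10 : ∀ z, E1 (E0 z) = - E0 (E1 z)
  P0U0 : ∀ z, P0 (U0 z) = z + U0 (P0 z)
  P1U1 : ∀ z, P1 (U1 z) = z + U1 (P1 z)
  P0U1 : ∀ z, P0 (U1 z) = U1 (P0 z)
  P1U0 : ∀ z, P1 (U0 z) = U0 (P1 z)
  VD0 : ∀ z, D0 (V z) = V (D0 z)
  VD1 : ∀ z, D1 (V z) = V (D1 z)
  VE0 : ∀ z, E0 (V z) = V (E0 z)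
  VE1 : ∀ z, E1 (V z) = V (E1 z)
  VU0 : ∀ z, U0 (V z) = V (U0 z)
  VU1 : ∀ z, U1 (V z) = V (U1 z)
  VP0 : ∀ z, P0 (V z) = V (P0 z)
  VP1 : ∀ z, P1 (V z) = V (P1 z)
  U0D0 : ∀ z, D0 (U0 z) = U0 (D0 z)
  U0D1 : ∀ z, D1 (U0 z) = U0 (D1 z)
  U0E0 : ∀ z, E0 (U0 z) = U0 (E0 z)
  U0E1 : ∀ z, E1 (U0 z) = U0 (E1 z)
  U1D0 : ∀ z, D0 (U1 z) = U1 (D0 z)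
  U1D1 : ∀ z, D1 (U1 z) = U1 (D1 z)
  U1E0 : ∀ z, E0 (U1 z) = U1 (E0 z)
  U1E1 : ∀ z, E1 (U1 z) = U1 (E1 z)
  P0D0 : ∀ z, D0 (P0 z) = P0 (D0 z)
  P0D1 : ∀ z, D1 (P0 z) = P0 (D1 z)
  P0E0 : ∀ z, E0 (P0 z) = P0 (E0 z)
  P0E1 : ∀ z, E1 (P0 z) = P0 (E1 z)
  P1D0 : ∀ z, D0 (P1 z) = P1 (D0 z)
  P1D1 : ∀ z, D1 (P1 z) = P1 (D1 z)
  P1E0 : ∀ z, E0 (P1 z) = P1 (E0 z)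
  P1E1 : ∀ z, E1 (P1 z) = P1 (E1 z)
  Vinj : ∀ z, V z = 0 → z = 0

structure Gr {M : Type*} [AddCommGroup M] [Module ℂ M]
    (V D0 D1 E0 E1 U0 U1 P0 P1 : M →ₗ[ℂ] M) (G : ℤ → ℤ → ℤ → Submodule ℂ M) : Prop where
  GV : ∀ a m n z, z ∈ G a m n → V z ∈ G (a - 1) m (n - 1)
  GD0 : ∀ a m n z, z ∈ G a m n → D0 z ∈ G (a - 1) m n
  GD1 : ∀ a m n z, z ∈ G a m n → D1 z ∈ G (a - 1) m n
  GE0 : ∀ a m n z, z ∈ G a m n → E0 z ∈ G a m (n - 1)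
  GE1 : ∀ a m n z, z ∈ G a m n → E1 z ∈ G a m (n - 1)
  GP0 : ∀ a m n z, z ∈ G a m n → P0 z ∈ G a (m + 1) n
  GP1 : ∀ a m n z, z ∈ G a m n → P1 z ∈ G a (m + 1) n
  div : ∀ a m n z, a ≤ 0 → z ∈ G (a - 1) m (n - 1) → ∃ y ∈ G a m n, V y = z
  euler : ∀ a m n z, z ∈ G a m n → U0 (P0 z) + U1 (P1 z) = (-(m : ℂ)) • z
  G1 : ∀ a n, G a 1 n = ⊥

section core
variable {M : Type*} [AddCommGroup M] [Module ℂ M]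
    {V D0 D1 E0 E1 U0 U1 P0 P1 : M →ₗ[ℂ] M} {G : ℤ → ℤ → ℤ → Submodule ℂ M}

theorem core_hom (S : Sys V D0 D1 E0 E1 U0 U1 P0 P1) (z : M)
    (h : U0 (E0 z) + U1 (E1 z) = 0) :
    (U0 (E0 (P0 (D0 z) + P1 (D1 z))) + U1 (E1 (P0 (D0 z) + P1 (D1 z)))) =
     (2 : ℂ) • V z + V (U0 (P0 z) + U1 (P1 z)) - (E0 (D0 z) + E1 (D1 z)) := by
  have e : P0 (D0 (U0 (E0 z) + U1 (E1 z))) + P1 (D1 (U0 (E0 z) + U1 (E1 z))) = 0 := by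
    simp [h]
  rw [← add_zero (U0 (E0 (P0 (D0 z) + P1 (D1 z))) + U1 (E1 (P0 (D0 z) + P1 (D1 z)))), ← e]
  simp only [map_add, map_sub, map_neg, S.D0E0, S.D1E1, S.D0E1, S.D1E0, S.P0U0, S.P1U1, S.P0U1,
    S.P1U0, S.VP0, S.VP1, S.VU0, S.VU1, S.U0D0, S.U0D1, S.U1D0, S.U1D1, S.P0E0, S.P0E1,
    S.P1E0, S.P1E1]
  module

theorem core_nu (S : Sys V D0 D1 E0 E1 U0 U1 P0 P1) (z : M)
    (h : U0 (E0 z) + U1 (E1 z) = 0) :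
    U0 (E0 (E0 (D0 z) + E1 (D1 z))) + U1 (E1 (E0 (D0 z) + E1 (D1 z))) = 0 := by
  have e : E0 (D0 (U0 (E0 z) + U1 (E1 z))) + E1 (D1 (U0 (E0 z) + U1 (E1 z)))
    - V (U0 (E0 z) + U1 (E1 z)) = 0 := by
    simp [h]
  rw [← e]
  simp only [map_add, map_sub, map_neg, map_zero, S.D0E0, S.D1E1, S.D0E1, S.D1E0, S.VE0, S.VE1,
    S.VU0, S.VU1, S.U0D0, S.U0D1, S.U1D0, S.U1D1, S.U0E0, S.U0E1, S.U1E0, S.U1E1,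
    S.E00, S.E11, S.E10]
  module

theorem core_poly (S : Sys V D0 D1 E0 E1 U0 U1 P0 P1) (ν : M →ₗ[ℂ] M)
    (hν : ν = E0 ∘ₗ D0 + E1 ∘ₗ D1) (z : M) :
    ν (ν (ν z)) = (3 : ℂ) • V (ν (ν z)) - (2 : ℂ) • V (V (ν z)) := by
  subst hν
  simp only [LinearMap.add_apply, LinearMap.comp_apply, map_add, map_sub, map_neg, map_zero,
    S.D0E0, S.D1E1, S.D0E1, S.D1E0, S.VE0, S.VE1, S.VD0, S.VD1,
    S.E00, S.E11, S.E10, S.D00, S.D11, S.D10, smul_add, smul_sub, smul_neg, neg_neg, neg_zero,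
    sub_zero, zero_sub, add_zero, zero_add]
  module

theorem core_exact (S : Sys V D0 D1 E0 E1 U0 U1 P0 P1) (T : Gr V D0 D1 E0 E1 U0 U1 P0 P1 G)
    (a m n : ℤ) (ha : a < 0) (hm : m < 0) (z : M) (hz : z ∈ G a m n)
    (h : U0 (E0 z) + U1 (E1 z) = 0) :
    ∃ y ∈ G a (m + 1) (n + 1), U0 (E0 y) + U1 (E1 y) = z := by
  obtain ⟨ν, hν⟩ : ∃ ν : M →ₗ[ℂ] M, ν = E0 ∘ₗ D0 + E1 ∘ₗ D1 := ⟨_, rfl⟩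
  have hν' : ∀ x, ν x = E0 (D0 x) + E1 (D1 x) := by intro x; simp [hν]
  have Gν : ∀ a m n z, z ∈ G a m n → ν z ∈ G (a - 1) m (n - 1) := by
    intro a m n z hz
    rw [hν']
    exact add_mem (T.GE0 _ _ _ _ (T.GD0 _ _ _ _ hz)) (T.GE1 _ _ _ _ (T.GD1 _ _ _ _ hz))
  have Vν : ∀ x, ν (V x) = V (ν x) := by
    intro x; simp [hν', S.VD0, S.VD1, S.VE0, S.VE1]
  have h1 : U0 (E0 (ν z)) + U1 (E1 (ν z)) = 0 := by rw [hν']; exact core_nu S z h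
  have h2 : U0 (E0 (ν (ν z))) + U1 (E1 (ν (ν z))) = 0 := by
    rw [hν' (ν z)]; exact core_nu S _ h1
  set c : ℂ := 2 - m with hc
  set w : M := (c^2 - 3 * c + 2) • V (V z) + (c - 3) • V (ν z) + ν (ν z) with hw
  have wmem : w ∈ G (a - 1 - 1) m (n - 1 - 1) := by
    refine add_mem (add_mem ?_ ?_) ?_
    · exact Submodule.smul_mem _ _ (T.GV _ _ _ _ (T.GV _ _ _ _ hz))
    · exact Submodule.smul_mem _ _ (T.GV _ _ _ _ (Gν _ _ _ _ hz))
    · exact (Gν _ _ _ _ (Gν _ _ _ _ hz))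
  have hwk : U0 (E0 w) + U1 (E1 w) = 0 := by
    have : U0 (E0 w) + U1 (E1 w) = (c^2 - 3 * c + 2) • V (V (U0 (E0 z) + U1 (E1 z)))
      + (c - 3) • V (U0 (E0 (ν z)) + U1 (E1 (ν z))) + (U0 (E0 (ν (ν z))) + U1 (E1 (ν (ν z)))) := by
      simp only [hw, map_add, map_smul, S.VE0, S.VE1, S.VU0, S.VU1]
      module
    rw [this, h, h1, h2]; simp
  have key := core_hom S w hwk
  rw [T.euler _ _ _ _ wmem, ← hν'] at key
  have ymem : P0 (D0 w) + P1 (D1 w) ∈ G (a - 1 - 1 - 1) (m + 1) (n + 1 - 1 - 1 - 1) := by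
    have : n + 1 - 1 - 1 - 1 = n - 1 - 1 := by ring
    rw [this]
    exact add_mem (T.GP0 _ _ _ _ (T.GD0 _ _ _ _ wmem)) (T.GP1 _ _ _ _ (T.GD1 _ _ _ _ wmem))
  obtain ⟨y1, hy1, e1⟩ := T.div _ _ _ _ (by omega) ymem
  obtain ⟨y2, hy2, e2⟩ := T.div _ _ _ _ (by omega) hy1
  obtain ⟨y3, hy3, e3⟩ := T.div _ _ _ _ (by omega) hy2
  have hp : c * (c - 1) * (c - 2) ≠ 0 := by
    have q0 : c ≠ 0 := by
      rw [hc]; exact_mod_cast (show (2 - m : ℤ) ≠ 0 by omega)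
    have q1 : c - 1 ≠ 0 := by
      rw [hc]; exact_mod_cast (show (2 - m - 1 : ℤ) ≠ 0 by omega)
    have q2 : c - 2 ≠ 0 := by
      rw [hc]; exact_mod_cast (show (2 - m - 2 : ℤ) ≠ 0 by omega)
    exact mul_ne_zero (mul_ne_zero q0 q1) q2
  refine ⟨(c * (c - 1) * (c - 2))⁻¹ • y3, Submodule.smul_mem _ _ hy3, ?_⟩
  have fin : (U0 (E0 y3) + U1 (E1 y3)) = (c * (c - 1) * (c - 2)) • z := by
    rw [← sub_eq_zero]
    apply S.Vinj
    apply S.Vinj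
    apply S.Vinj
    have e4 : V (V (V (U0 (E0 y3) + U1 (E1 y3)))) =
        U0 (E0 (V (V (V y3)))) + U1 (E1 (V (V (V y3)))) := by
      simp only [map_add, S.VE0, S.VE1, S.VU0, S.VU1]
    simp only [map_sub]
    rw [e4, e3, e2, e1, key]
    have hcm : (m : ℂ) = 2 - c := by rw [hc]; ring
    rw [hcm, hw]
    simp only [map_add, map_smul, Vν, core_poly S ν hν]
    module
  simp only [map_smul]
  rw [← smul_add, fin, smul_smul, inv_mul_cancel₀ hp, one_smul]

theorem core_ker (S : Sys V D0 D1 E0 E1 U0 U1 P0 P1) (T : Gr V D0 D1 E0 E1 U0 U1 P0 P1 G)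
    (a n : ℤ) (ha : a < 0) (z : M) (hz : z ∈ G a 0 n)
    (h : U0 (E0 z) + U1 (E1 z) = 0) :
    ∃ w ∈ G a 0 (n + 2), D0 w = 0 ∧ D1 w = 0 ∧ z = E0 (E1 w) := by
  have p0 : P0 z = 0 := by
    have := T.GP0 _ _ _ _ hz
    rw [zero_add, T.G1] at this; simpa using this
  have p1 : P1 z = 0 := by
    have := T.GP1 _ _ _ _ hz
    rw [zero_add, T.G1] at this; simpa using this
  have e0 : E0 z = 0 := by
    have : P0 (U0 (E0 z) + U1 (E1 z)) = 0 := by rw [h, map_zero]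
    simpa [S.P0U0, S.P0U1, ← S.P0E0, ← S.P0E1, p0] using this
  have e1 : E1 z = 0 := by
    have : P1 (U0 (E0 z) + U1 (E1 z)) = 0 := by rw [h, map_zero]
    simpa [S.P1U0, S.P1U1, ← S.P1E0, ← S.P1E1, p1] using this
  have mem : - D0 (D1 z) ∈ G (a - 1 - 1) 0 (n + 2 - 1 - 1) := by
    have : n + 2 - 1 - 1 = n := by ring
    rw [this]
    exact neg_mem (T.GD0 _ _ _ _ (T.GD1 _ _ _ _ hz))
  obtain ⟨w1, hw1, q1⟩ := T.div _ _ _ _ (by omega) mem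
  obtain ⟨w, hw, q2⟩ := T.div _ _ _ _ (by omega) hw1
  have q : V (V w) = - D0 (D1 z) := by rw [q2, q1]
  refine ⟨w, hw, ?_, ?_, ?_⟩
  · apply S.Vinj; apply S.Vinj
    rw [← S.VD0, ← S.VD0, q, map_neg, S.D00, neg_zero]
  · apply S.Vinj; apply S.Vinj
    rw [← S.VD1, ← S.VD1, q, map_neg, S.D10, S.D11]; simp
  · rw [← sub_eq_zero]
    apply S.Vinj; apply S.Vinj
    have r0 : V z = E0 (D0 z) := by
      have := S.D0E0 z
      rw [e0, map_zero] at this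
      exact (sub_eq_zero.mp this.symm)
    have r1 : V z = E1 (D1 z) := by
      have := S.D1E1 z
      rw [e1, map_zero] at this
      exact (sub_eq_zero.mp this.symm)
    have r2 : V (V z) = - E0 (E1 (D0 (D1 z))) := by
      conv_lhs => rw [r0, ← S.VE0, ← S.VD0, r1, S.D0E1, map_neg]
    simp only [map_sub]
    rw [r2, ← S.VE0, ← S.VE1, ← S.VE0, ← S.VE1, q]
    simp

theorem core_inj (S : Sys V D0 D1 E0 E1 U0 U1 P0 P1) (w : M) (h0 : D0 w = 0) (h1 : D1 w = 0)
    (h : E0 (E1 w) = 0) : w = 0 := by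
  apply S.Vinj; apply S.Vinj
  have : D1 (D0 (E0 (E1 w))) = 0 := by rw [h]; simp
  simpa [S.D0E0, S.D1E1, S.D0E1, S.D1E0, h0, h1, S.VD1] using this

theorem core_equiv {X : Type*} [AddCommGroup X] [Module ℂ X]
    (S : Sys V D0 D1 E0 E1 U0 U1 P0 P1) (T : Gr V D0 D1 E0 E1 U0 U1 P0 P1 G)
    (N : M →ₗ[ℂ] M) (hN : ∀ z, N z = U0 (E0 z) + U1 (E1 z))
    (a n : ℤ) (ha : a < 0) (i : X →ₗ[ℂ] M) (hi : ∀ x, i x = 0 → x = 0)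
    (hX : ∀ x, i x ∈ G a 0 (n + 2) ∧ D0 (i x) = 0 ∧ D1 (i x) = 0)
    (hW : ∀ w ∈ G a 0 (n + 2), D0 w = 0 → D1 w = 0 → ∃ x, i x = w) :
    Nonempty (X ≃ₗ[ℂ] ↥(G a 0 n ⊓ LinearMap.ker N)) := by
  have mem : ∀ x, E0 (E1 (i x)) ∈ G a 0 n ⊓ LinearMap.ker N := by
    intro x
    refine ⟨?_, ?_⟩
    · have := T.GE0 _ _ _ _ (T.GE1 _ _ _ _ (hX x).1)
      have e : n + 2 - 1 - 1 = n := by ring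
      rwa [e] at this
    · rw [SetLike.mem_coe, LinearMap.mem_ker, hN]
      simp [S.E00, S.E11, S.E10]
  refine ⟨LinearEquiv.ofBijective ((E0 ∘ₗ E1 ∘ₗ i).codRestrict _ mem) ⟨?_, ?_⟩⟩
  · rw [injective_iff_map_eq_zero]
    intro x hx
    have hx' : E0 (E1 (i x)) = 0 := congrArg Subtype.val hx
    exact hi x (core_inj S _ (hX x).2.1 (hX x).2.2 hx')
  · rintro ⟨z, hz1, hz2⟩
    rw [SetLike.mem_coe, LinearMap.mem_ker, hN] at hz2
    obtain ⟨w, hw, a0, a1, e⟩ := core_ker S T a n ha z hz1 hz2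
    obtain ⟨x, rfl⟩ := hW w hw a0 a1
    exact ⟨x, Subtype.ext e.symm⟩
end core

def win : Fin 2 → Fin 4 := fun i => ⟨i.1 + 2, by have := i.2; omega⟩

def dd (i : Fin 4) : Ex →ₗ[ℂ] Ex := CliffordAlgebra.contractLeft (LinearMap.proj i)

theorem dd_f_mul (i j : Fin 4) (x : Ex) :
    dd i (f j * x) = (if i = j then x else 0) - f j * dd i x := by
  have := CliffordAlgebra.contractLeft_ι_mul (Q := (0 : QuadraticForm ℂ (Fin 4 → ℂ)))
    (LinearMap.proj i) (Pi.single j 1) x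
  refine this.trans ?_
  congr 1
  by_cases h : i = j
  · subst h; simp
  · simp [h]

theorem dd_dd (i : Fin 4) (x : Ex) : dd i (dd i x) = 0 :=
  CliffordAlgebra.contractLeft_contractLeft _ _

theorem dd_comm (i j : Fin 4) (x : Ex) : dd i (dd j x) = - dd j (dd i x) :=
  CliffordAlgebra.contractLeft_comm _ _ _

theorem dd_one (i : Fin 4) : dd i 1 = 0 := CliffordAlgebra.contractLeft_one _ _

theorem f_sq (i : Fin 4) : f i * f i = 0 := ExteriorAlgebra.ι_sq_zero _

theorem f_sq_mul (i : Fin 4) (x : Ex) : f i * (f i * x) = 0 := by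
  rw [← mul_assoc, f_sq, zero_mul]

theorem f_anti (i j : Fin 4) : f i * f j = - (f j * f i) :=
  eq_neg_of_add_eq_zero_left (ExteriorAlgebra.ι_add_mul_swap _ _)

theorem f_anti_mul (i j : Fin 4) (x : Ex) : f i * (f j * x) = - (f j * (f i * x)) := by
  rw [← mul_assoc, f_anti, neg_mul, mul_assoc]

def PL (c : Fin 2 → Fin 4) (l : List (Fin 2)) : Ex := (l.map (fun i => f (c i))).prod

theorem PL_nil (c : Fin 2 → Fin 4) : PL c [] = 1 := rfl

theorem PL_cons (c : Fin 2 → Fin 4) (i : Fin 2) (l : List (Fin 2)) :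
    PL c (i :: l) = f (c i) * PL c l := by simp [PL]

theorem mem_gen (lp lm : List (Fin 2)) (k l : ℤ) (hk : (lp.length : ℤ) = k)
    (hl : (lm.length : ℤ) = l) : PL uin lp * PL win lm ∈ lamPM k l :=
  Submodule.subset_span ⟨lp, lm, hk, hl, rfl⟩

theorem lam_ind (S : Submodule ℂ Ex) (T : Ex →ₗ[ℂ] Ex) (k l : ℤ)
    (h : ∀ lp lm : List (Fin 2), (lp.length : ℤ) = k → (lm.length : ℤ) = l →
      T (PL uin lp * PL win lm) ∈ S) (ω : Ex) (hω : ω ∈ lamPM k l) : T ω ∈ S := by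
  have : lamPM k l ≤ S.comap T := by
    refine Submodule.span_le.mpr ?_
    rintro x ⟨lp, lm, h1, h2, rfl⟩
    exact h lp lm h1 h2
  exact this hω

theorem f_PL (i : Fin 4) (c : Fin 2 → Fin 4) (l : List (Fin 2)) (x : Ex) :
    f i * (PL c l * x) = (-1 : ℂ) ^ l.length • (PL c l * (f i * x)) := by
  induction l with
  | nil => simp [PL_nil]
  | cons j l ih =>
    rw [PL_cons, mul_assoc, f_anti_mul, ih, mul_smul_comm, List.length_cons, pow_succ, mul_assoc]
    simp

theorem fp_mem (i : Fin 2) (k l : ℤ) (ω : Ex) (h : ω ∈ lamPM k l) :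
    f (uin i) * ω ∈ lamPM (k + 1) l := by
  refine lam_ind _ (LinearMap.mulLeft ℂ (f (uin i))) k l ?_ ω h
  intro lp lm h1 h2
  rw [LinearMap.mulLeft_apply, ← mul_assoc, ← PL_cons]
  exact mem_gen _ _ _ _ (by simp [h1]) h2

theorem fm_mem (i : Fin 2) (k l : ℤ) (ω : Ex) (h : ω ∈ lamPM k l) :
    f (win i) * ω ∈ lamPM k (l + 1) := by
  refine lam_ind _ (LinearMap.mulLeft ℂ (f (win i))) k l ?_ ω h
  intro lp lm h1 h2
  rw [LinearMap.mulLeft_apply, f_PL, ← PL_cons]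
  exact Submodule.smul_mem _ _ (mem_gen _ _ _ _ h1 (by simp [h2]))

theorem dd_PL (i : Fin 4) (c : Fin 2 → Fin 4) (hc : ∀ j, i ≠ c j) (l : List (Fin 2)) (x : Ex) :
    dd i (PL c l * x) = (-1 : ℂ) ^ l.length • (PL c l * dd i x) := by
  induction l with
  | nil => simp [PL_nil]
  | cons j l ih =>
    rw [PL_cons, mul_assoc, dd_f_mul, if_neg (hc j), ih, mul_smul_comm, List.length_cons,
      pow_succ, mul_assoc]
    simp

theorem uin_ne_win (i j : Fin 2) : uin i ≠ win j := by
  intro h; have := congrArg Fin.val h; simp [uin, win] at this; omega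

theorem dd_win_PL (i : Fin 2) (l : List (Fin 2)) : dd (win i) (PL uin l) = 0 := by
  have := dd_PL (win i) uin (fun j h => uin_ne_win _ _ h.symm) l 1
  simpa [dd_one] using this

theorem dd_uin_PL (i : Fin 2) (l : List (Fin 2)) : dd (uin i) (PL win l) = 0 := by
  have := dd_PL (uin i) win (fun j h => uin_ne_win _ _ h) l 1
  simpa [dd_one] using this

theorem dp_mem (i : Fin 2) (k l : ℤ) (ω : Ex) (h : ω ∈ lamPM k l) :
    dd (uin i) ω ∈ lamPM (k - 1) l := by
  refine lam_ind _ (dd (uin i)) k l ?_ ω h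
  intro lp lm h1 h2
  subst h1 h2
  clear h
  induction lp with
  | nil => simp [PL_nil, dd_uin_PL]
  | cons j lp ih =>
    rw [PL_cons, mul_assoc, dd_f_mul]
    refine sub_mem ?_ ?_
    · split_ifs
      · exact mem_gen _ _ _ _ (by simp) rfl
      · exact zero_mem _
    · have := fp_mem j _ _ _ ih
      have e : ((lp.length : ℤ) - 1 + 1) = ((j :: lp).length : ℤ) - 1 := by
        rw [List.length_cons]; push_cast; ring
      rwa [e] at this

theorem dm_mem (i : Fin 2) (k l : ℤ) (ω : Ex) (h : ω ∈ lamPM k l) :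
    dd (win i) ω ∈ lamPM k (l - 1) := by
  refine lam_ind _ (dd (win i)) k l ?_ ω h
  intro lp lm h1 h2
  rw [dd_PL _ _ (fun j h => uin_ne_win _ _ h.symm)]
  refine Submodule.smul_mem _ _ ?_
  have h0 : dd (win i) (PL win lm) ∈ lamPM 0 (l - 1) := by
    subst h2
    clear h h1
    induction lm with
    | nil => simp [PL_nil, dd_one]
    | cons j lm ih =>
      rw [PL_cons, dd_f_mul]
      refine sub_mem ?_ ?_
      · split_ifs
        · have := mem_gen [] lm 0 (((j :: lm).length : ℤ) - 1) (by simp) (by simp)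
          simpa [PL_nil] using this
        · exact zero_mem _
      · have := fm_mem j _ _ _ ih
        have e : ((lm.length : ℤ) - 1 + 1) = ((j :: lm).length : ℤ) - 1 := by
          rw [List.length_cons]; push_cast; ring
        rwa [e] at this
  subst h1
  clear h h2
  generalize dd (win i) (PL win lm) = y at h0
  induction lp with
  | nil => simpa [PL_nil] using h0
  | cons j lp ih =>
    rw [PL_cons, mul_assoc, List.length_cons]
    push_cast
    exact fp_mem j _ _ _ ih

/-- projection killing multiples of `f i`, `f j`. -/
def prj (i j : Fin 4) : Ex →ₗ[ℂ] Ex :=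
  dd i ∘ₗ LinearMap.mulLeft ℂ (f i) ∘ₗ dd j ∘ₗ LinearMap.mulLeft ℂ (f j)

theorem prj_apply (i j : Fin 4) (x : Ex) : prj i j x = dd i (f i * dd j (f j * x)) := rfl

theorem prj_f2 (i j : Fin 4) (x : Ex) : prj i j (f j * x) = 0 := by
  rw [prj_apply, f_sq_mul]; simp

theorem prj_f1 (i j : Fin 4) (hij : i ≠ j) (x : Ex) : prj i j (f i * x) = 0 := by
  rw [prj_apply, f_anti_mul, map_neg, dd_f_mul j i, if_neg hij.symm, zero_sub, neg_neg, f_sq_mul]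
  simp

theorem prj_id (i j : Fin 4) (x : Ex) (hi : dd i x = 0) (hj : dd j x = 0) : prj i j x = x := by
  rw [prj_apply, dd_f_mul j j, if_pos rfl, hj, mul_zero, sub_zero, dd_f_mul, if_pos rfl, hi]; simp

theorem prj_p (k l : ℤ) (hk : k ≠ 0) (ω : Ex) (h : ω ∈ lamPM k l) : prj 0 1 ω = 0 := by
  have : prj 0 1 ω ∈ (⊥ : Submodule ℂ Ex) := by
    refine lam_ind _ _ k l ?_ ω h
    intro lp lm h1 h2
    rcases lp with _ | ⟨j, lp⟩
    · simp at h1; omega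
    · rw [PL_cons, mul_assoc, Submodule.mem_bot]
      fin_cases j
      · exact prj_f1 0 1 (by decide) _
      · exact prj_f2 0 1 _
  simpa using this

theorem prj_m (k l : ℤ) (hl : l ≠ 0) (ω : Ex) (h : ω ∈ lamPM k l) : prj 2 3 ω = 0 := by
  have : prj 2 3 ω ∈ (⊥ : Submodule ℂ Ex) := by
    refine lam_ind _ _ k l ?_ ω h
    intro lp lm h1 h2
    rcases lm with _ | ⟨j, lm⟩
    · simp at h2; omega
    · have e := f_PL (win j) uin lp (PL win lm)
      have e2 : PL uin lp * (f (win j) * PL win lm) =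
          (-1 : ℂ) ^ lp.length • (f (win j) * (PL uin lp * PL win lm)) := by
        rw [e, smul_smul, ← mul_pow]; simp
      rw [PL_cons, e2, Submodule.mem_bot, map_smul]
      fin_cases j
      · rw [show f (win ((fun i => i) (⟨0, by decide⟩ : Fin 2))) = f 2 from rfl, prj_f1 2 3 (by decide), smul_zero]
      · rw [show f (win ((fun i => i) (⟨1, by decide⟩ : Fin 2))) = f 3 from rfl, prj_f2 2 3, smul_zero]
  simpa using this

theorem dp_zero (i : Fin 2) (l : ℤ) (ω : Ex) (h : ω ∈ lamPM 0 l) : dd (uin i) ω = 0 := by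
  have : dd (uin i) ω ∈ (⊥ : Submodule ℂ Ex) := by
    refine lam_ind _ _ 0 l ?_ ω h
    intro lp lm h1 h2
    have : lp = [] := by
      rw [← List.length_eq_zero_iff]; exact_mod_cast h1
    subst this
    simp [PL_nil, dd_uin_PL]
  simpa using this

theorem dm_zero (i : Fin 2) (k : ℤ) (ω : Ex) (h : ω ∈ lamPM k 0) : dd (win i) ω = 0 := by
  have : dd (win i) ω ∈ (⊥ : Submodule ℂ Ex) := by
    refine lam_ind _ _ k 0 ?_ ω h
    intro lp lm h1 h2
    have : lm = [] := by
      rw [← List.length_eq_zero_iff]; exact_mod_cast h2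
    subst this
    simp [PL_nil, dd_win_PL]
  simpa using this

theorem lam_neg1 (k l : ℤ) (hk : k < 0) : lamPM k l = ⊥ := by
  refine (Submodule.span_eq_bot).mpr ?_
  rintro x ⟨lp, lm, h1, h2, rfl⟩
  omega

theorem lam_neg2 (k l : ℤ) (hk : l < 0) : lamPM k l = ⊥ := by
  refine (Submodule.span_eq_bot).mpr ?_
  rintro x ⟨lp, lm, h1, h2, rfl⟩
  omega

/-- span of the length `j` products -/
def lamC (c : Fin 2 → Fin 4) (j : ℤ) : Submodule ℂ Ex :=
  Submodule.span ℂ {x | ∃ l : List (Fin 2), (l.length : ℤ) = j ∧ x = PL c l}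

theorem lam_p (j : ℤ) : lamPM j 0 = lamC uin j := by
  apply le_antisymm
  · refine Submodule.span_le.mpr ?_
    rintro x ⟨lp, lm, h1, h2, rfl⟩
    have : lm = [] := by
      rw [← List.length_eq_zero_iff]; exact_mod_cast h2
    subst this
    exact Submodule.subset_span ⟨lp, h1, by simp [PL, uin]⟩
  · refine Submodule.span_le.mpr ?_
    rintro x ⟨lp, h1, rfl⟩
    have := mem_gen lp [] j 0 h1 rfl
    simpa [PL_nil] using this

theorem lam_m (j : ℤ) : lamPM 0 j = lamC win j := by
  apply le_antisymm
  · refine Submodule.span_le.mpr ?_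
    rintro x ⟨lp, lm, h1, h2, rfl⟩
    have : lp = [] := by
      rw [← List.length_eq_zero_iff]; exact_mod_cast h1
    subst this
    exact Submodule.subset_span ⟨lm, h2, by simp [PL, win]⟩
  · refine Submodule.span_le.mpr ?_
    rintro x ⟨lp, h1, rfl⟩
    have := mem_gen [] lp 0 j rfl h1
    simpa [PL_nil] using this

theorem f_ind (c : Fin 2 → Fin 4) (hc : c 0 ≠ c 1) :
    LinearIndependent ℂ ![f (c 0), f (c 1)] := by
  rw [LinearIndependent.pair_iff]
  intro s t h
  have h0 := congrArg (dd (c 0)) h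
  have h1 := congrArg (dd (c 1)) h
  have e : ∀ i j : Fin 4, dd i (f j) = if i = j then 1 else 0 := by
    intro i j
    have := dd_f_mul i j 1
    simpa [dd_one] using this
  simp [e, hc, hc.symm] at h0 h1
  exact ⟨h0, h1⟩

theorem ff_ne (c : Fin 2 → Fin 4) (hc : c 0 ≠ c 1) : f (c 0) * f (c 1) ≠ 0 := by
  intro h
  have h0 := congrArg (dd (c 0)) h
  have e : dd (c 0) (f (c 1)) = 0 := by
    have := dd_f_mul (c 0) (c 1) 1
    simpa [dd_one, hc] using this
  rw [dd_f_mul, if_pos rfl, e] at h0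
  simp at h0
  exact (f_ind c hc).ne_zero 1 h0

theorem lamC_equiv (c : Fin 2 → Fin 4) (hc : c 0 ≠ c 1) (j : ℤ) :
    Nonempty (lamC c j ≃ₗ[ℂ] (Fin (zbinom j) → ℂ)) := by
  have key : ∀ (m : ℕ) (b : Fin m → Ex), LinearIndependent ℂ b →
      lamC c j = Submodule.span ℂ (Set.range b) → zbinom j = m →
      Nonempty (lamC c j ≃ₗ[ℂ] (Fin (zbinom j) → ℂ)) := by
    intro m b hb hs hm
    rw [hs, hm]
    exact ⟨(Module.Basis.span hb).equivFun⟩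
  have zero : lamC c j = ⊥ → zbinom j = 0 → Nonempty (lamC c j ≃ₗ[ℂ] (Fin (zbinom j) → ℂ)) := by
    intro h h'
    refine key 0 ![] (linearIndependent_empty_type) ?_ h'
    simp [h]
  rcases lt_or_ge j 0 with hj | hj
  · apply zero
    · refine (Submodule.span_eq_bot).mpr ?_
      rintro x ⟨lp, h1, rfl⟩
      omega
    · simp [zbinom]; omega
  obtain ⟨n, rfl⟩ := Int.eq_ofNat_of_zero_le hj
  have hl : ∀ l : List (Fin 2), (l.length : ℤ) = n ↔ l.length = n := fun l => by norm_cast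
  match n with
  | 0 =>
    refine key 1 ![1] ?_ ?_ (by simp [zbinom])
    · exact LinearIndependent.of_subsingleton 0 (by simp)
    · apply le_antisymm
      · refine Submodule.span_mono ?_
        rintro x ⟨l, h1, rfl⟩
        rw [hl, List.length_eq_zero_iff] at h1
        subst h1
        exact ⟨0, rfl⟩
      · refine Submodule.span_mono ?_
        rintro x ⟨i, rfl⟩
        exact ⟨[], rfl, by fin_cases i; rfl⟩
  | 1 =>
    refine key 2 _ (f_ind c hc) ?_ (by simp [zbinom])
    apply le_antisymm
    · refine Submodule.span_mono ?_
      rintro x ⟨l, h1, rfl⟩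
      rw [hl, List.length_eq_one_iff] at h1
      obtain ⟨i, rfl⟩ := h1
      exact ⟨i, by fin_cases i <;> simp [PL]⟩
    · refine Submodule.span_mono ?_
      rintro x ⟨i, rfl⟩
      exact ⟨[i], rfl, by fin_cases i <;> simp [PL]⟩
  | 2 =>
    refine key 1 ![f (c 0) * f (c 1)] ?_ ?_ (by simp [zbinom])
    · exact LinearIndependent.of_subsingleton 0 (ff_ne c hc)
    · apply le_antisymm
      · refine Submodule.span_le.mpr ?_
        rintro x ⟨l, h1, rfl⟩
        rw [hl, List.length_eq_two] at h1
        obtain ⟨i, i', rfl⟩ := h1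
        have hm : f (c 0) * f (c 1) ∈ Submodule.span ℂ (Set.range ![f (c 0) * f (c 1)]) :=
          Submodule.subset_span ⟨0, rfl⟩
        have e : PL c [i, i'] = f (c i) * f (c i') := by simp [PL]
        rw [e]
        fin_cases i <;> fin_cases i' <;> simp only [Fin.zero_eta, Fin.mk_one, f_sq]
        · exact zero_mem _
        · exact hm
        · have h2 := neg_mem hm
          have e3 : -(f (c 0) * f (c 1)) = f (c 1) * f (c 0) := by rw [f_anti (c 0), neg_neg]
          rwa [e3] at h2
        · exact zero_mem _
      · refine Submodule.span_mono ?_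
        rintro x ⟨i, rfl⟩
        exact ⟨[0, 1], rfl, by fin_cases i; simp [PL]⟩
  | n + 3 =>
    apply zero
    · refine (Submodule.span_eq_bot).mpr ?_
      rintro x ⟨l, h1, rfl⟩
      rw [hl] at h1
      match l with
      | i :: i' :: i'' :: l =>
        simp only [PL_cons]
        fin_cases i <;> fin_cases i' <;> fin_cases i'' <;>
          simp only [Fin.zero_eta, Fin.mk_one, f_sq_mul, mul_zero]
        · rw [f_anti_mul (c 1), mul_neg, f_sq_mul, neg_zero]
        · rw [f_anti_mul (c 0), mul_neg, f_sq_mul, neg_zero]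
    · have : 0 ≤ ((n + 3 : ℕ) : ℤ) := by positivity
      simp only [zbinom, if_pos this, Int.toNat_natCast]
      exact Nat.choose_eq_zero_of_lt (by omega)

def FO (i : Fin 4) : MEx →ₗ[ℂ] MEx := LinearMap.rTensor P4 (LinearMap.mulLeft ℂ (f i))
def DO (i : Fin 4) : MEx →ₗ[ℂ] MEx := LinearMap.rTensor P4 (dd i)
def MO (p : P4) : MEx →ₗ[ℂ] MEx := LinearMap.lTensor Ex (LinearMap.mulLeft ℂ p)
def PO (i : Fin 4) : MEx →ₗ[ℂ] MEx :=
  LinearMap.lTensor Ex ((MvPolynomial.pderiv i : Derivation ℂ P4 P4) : P4 →ₗ[ℂ] P4)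

theorem FO_t (i : Fin 4) (x : Ex) (y : P4) : FO i (x ⊗ₜ y) = (f i * x) ⊗ₜ y := rfl
theorem DO_t (i : Fin 4) (x : Ex) (y : P4) : DO i (x ⊗ₜ y) = (dd i x) ⊗ₜ y := rfl
theorem MO_t (p : P4) (x : Ex) (y : P4) : MO p (x ⊗ₜ y) = x ⊗ₜ (p * y) := rfl
theorem PO_t (i : Fin 4) (x : Ex) (y : P4) :
    PO i (x ⊗ₜ y) = x ⊗ₜ (MvPolynomial.pderiv i y) := rfl

theorem lin_ext (A B : MEx →ₗ[ℂ] MEx) (h : ∀ x y, A (x ⊗ₜ y) = B (x ⊗ₜ y)) (z : MEx) :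
    A z = B z := by
  have : A = B := TensorProduct.ext' h
  rw [this]

theorem DOFO (i j : Fin 4) (z : MEx) :
    DO i (FO j z) = (if i = j then z else 0) - FO j (DO i z) := by
  by_cases h : i = j
  · subst h
    refine (lin_ext (DO i ∘ₗ FO i) (LinearMap.id - FO i ∘ₗ DO i) ?_ z).trans (by simp)
    intro x y
    simp [DO_t, FO_t, dd_f_mul, TensorProduct.sub_tmul]
  · refine (lin_ext (DO i ∘ₗ FO j) (- FO j ∘ₗ DO i) ?_ z).trans (by simp [h])
    intro x y
    simp [DO_t, FO_t, dd_f_mul, TensorProduct.neg_tmul, h]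

theorem DODO (i : Fin 4) (z : MEx) : DO i (DO i z) = 0 := by
  refine (lin_ext (DO i ∘ₗ DO i) 0 ?_ z).trans (by simp)
  intro x y
  simp [DO_t, dd_dd]

theorem DODO' (i j : Fin 4) (z : MEx) : DO i (DO j z) = - DO j (DO i z) := by
  refine (lin_ext (DO i ∘ₗ DO j) (- DO j ∘ₗ DO i) ?_ z).trans (by simp)
  intro x y
  simp only [LinearMap.comp_apply, LinearMap.neg_apply, DO_t, ← TensorProduct.neg_tmul]
  rw [dd_comm]

theorem FOFO (i : Fin 4) (z : MEx) : FO i (FO i z) = 0 := by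
  refine (lin_ext (FO i ∘ₗ FO i) 0 ?_ z).trans (by simp)
  intro x y
  simp [FO_t, f_sq_mul]

theorem FOFO' (i j : Fin 4) (z : MEx) : FO i (FO j z) = - FO j (FO i z) := by
  refine (lin_ext (FO i ∘ₗ FO j) (- FO j ∘ₗ FO i) ?_ z).trans (by simp)
  intro x y
  simp only [LinearMap.comp_apply, LinearMap.neg_apply, FO_t, ← TensorProduct.neg_tmul]
  rw [f_anti_mul]

theorem MOMO (p q : P4) (z : MEx) : MO p (MO q z) = MO q (MO p z) := by
  refine lin_ext (MO p ∘ₗ MO q) (MO q ∘ₗ MO p) ?_ z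
  intro x y
  simp only [LinearMap.comp_apply, MO_t]
  rw [mul_left_comm]

theorem FOMO (i : Fin 4) (p : P4) (z : MEx) : FO i (MO p z) = MO p (FO i z) :=
  lin_ext (FO i ∘ₗ MO p) (MO p ∘ₗ FO i) (fun _ _ => rfl) z

theorem DOMO (i : Fin 4) (p : P4) (z : MEx) : DO i (MO p z) = MO p (DO i z) :=
  lin_ext (DO i ∘ₗ MO p) (MO p ∘ₗ DO i) (fun _ _ => rfl) z

theorem FOPO (i j : Fin 4) (z : MEx) : FO i (PO j z) = PO j (FO i z) :=
  lin_ext (FO i ∘ₗ PO j) (PO j ∘ₗ FO i) (fun _ _ => rfl) z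

theorem DOPO (i j : Fin 4) (z : MEx) : DO i (PO j z) = PO j (DO i z) :=
  lin_ext (DO i ∘ₗ PO j) (PO j ∘ₗ DO i) (fun _ _ => rfl) z

theorem POMO (i : Fin 4) (z : MEx) :
    PO i (MO (MvPolynomial.X i) z) = z + MO (MvPolynomial.X i) (PO i z) := by
  refine (lin_ext (PO i ∘ₗ MO (MvPolynomial.X i))
    (LinearMap.id + MO (MvPolynomial.X i) ∘ₗ PO i) ?_ z).trans (by simp)
  intro x y
  simp only [LinearMap.comp_apply, LinearMap.add_apply, MO_t, PO_t, LinearMap.id_apply,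
    ← TensorProduct.tmul_add]
  congr 1
  simp [Derivation.leibniz, add_comm]

theorem POMO' (i j : Fin 4) (h : i ≠ j) (z : MEx) :
    PO i (MO (MvPolynomial.X j) z) = MO (MvPolynomial.X j) (PO i z) := by
  refine (lin_ext (PO i ∘ₗ MO (MvPolynomial.X j)) (MO (MvPolynomial.X j) ∘ₗ PO i) ?_ z)
  intro x y
  simp only [LinearMap.comp_apply, MO_t, PO_t]
  congr 1
  simp [Derivation.leibniz, MvPolynomial.pderiv_X_of_ne h.symm]

theorem MO_inj (i : Fin 4) (z : MEx) (h : MO (MvPolynomial.X i) z = 0) : z = 0 := by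
  have hi : Function.Injective (LinearMap.mulLeft ℂ (MvPolynomial.X i : P4)) := by
    intro a b hab
    exact mul_left_cancel₀ (MvPolynomial.X_ne_zero i) hab
  have := Module.Flat.lTensor_preserves_injective_linearMap (M := Ex) _ hi
  exact this (h.trans (map_zero _).symm)

def EO0 : MEx →ₗ[ℂ] MEx := MO (MvPolynomial.X 2) ∘ₗ FO 0 + MO (MvPolynomial.X 3) ∘ₗ FO 2
def EO1 : MEx →ₗ[ℂ] MEx := MO (MvPolynomial.X 2) ∘ₗ FO 1 + MO (MvPolynomial.X 3) ∘ₗ FO 3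

theorem EO0_apply (z : MEx) :
    EO0 z = MO (MvPolynomial.X 2) (FO 0 z) + MO (MvPolynomial.X 3) (FO 2 z) := rfl
theorem EO1_apply (z : MEx) :
    EO1 z = MO (MvPolynomial.X 2) (FO 1 z) + MO (MvPolynomial.X 3) (FO 3 z) := rfl

theorem nabla_eq (z : MEx) :
    nabla z = MO (MvPolynomial.X 0) (EO0 z) + MO (MvPolynomial.X 1) (EO1 z) := by
  refine (lin_ext nabla (MO (MvPolynomial.X 0) ∘ₗ EO0 + MO (MvPolynomial.X 1) ∘ₗ EO1) ?_ z)
  intro x y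
  simp only [nabla, LinearMap.add_apply, LinearMap.comp_apply, EO0_apply, EO1_apply, map_add,
    FO_t, MO_t, TensorProduct.map_tmul, LinearMap.mulLeft_apply, mul_assoc]
  abel

theorem sys_p : Sys (MO (MvPolynomial.X 2)) (DO 0) (DO 1) EO0 EO1
    (MO (MvPolynomial.X 0)) (MO (MvPolynomial.X 1)) (PO 0) (PO 1) where
  D0E0 z := by simp [EO0_apply, DOMO, DOFO]; abel
  D1E1 z := by simp [EO1_apply, DOMO, DOFO]; abel
  D0E1 z := by simp [EO1_apply, DOMO, DOFO]; abel
  D1E0 z := by simp [EO0_apply, DOMO, DOFO]; abel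
  D00 := DODO _
  D11 := DODO _
  D10 := DODO' _ _
  E00 z := by
    simp only [EO0_apply, map_add, FOMO, FOFO, map_zero, FOFO' 2 0, map_neg,
      MOMO (MvPolynomial.X 3) (MvPolynomial.X 2)]; abel
  E11 z := by
    simp only [EO1_apply, map_add, FOMO, FOFO, map_zero, FOFO' 3 1, map_neg,
      MOMO (MvPolynomial.X 3) (MvPolynomial.X 2)]; abel
  E10 z := by
    simp only [EO1_apply, EO0_apply, map_add, FOMO, FOFO' 1 0, FOFO' 3 2, FOFO' 3 0, FOFO' 2 1,
      map_neg, MOMO (MvPolynomial.X 3) (MvPolynomial.X 2)]; abel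
  P0U0 := POMO _
  P1U1 := POMO _
  P0U1 := POMO' _ _ (by decide)
  P1U0 := POMO' _ _ (by decide)
  VD0 := DOMO _ _
  VD1 := DOMO _ _
  VE0 z := by simp only [EO0_apply, FOMO, map_add, MOMO (MvPolynomial.X 3) (MvPolynomial.X 2)]
  VE1 z := by simp only [EO1_apply, FOMO, map_add, MOMO (MvPolynomial.X 3) (MvPolynomial.X 2)]
  VU0 := MOMO _ _
  VU1 := MOMO _ _
  VP0 := POMO' _ _ (by decide)
  VP1 := POMO' _ _ (by decide)
  U0D0 := DOMO _ _
  U0D1 := DOMO _ _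
  U1D0 := DOMO _ _
  U1D1 := DOMO _ _
  U0E0 z := by simp only [EO0_apply, FOMO, map_add, MOMO _ (MvPolynomial.X 0)]
  U0E1 z := by simp only [EO1_apply, FOMO, map_add, MOMO _ (MvPolynomial.X 0)]
  U1E0 z := by simp only [EO0_apply, FOMO, map_add, MOMO _ (MvPolynomial.X 1)]
  U1E1 z := by simp only [EO1_apply, FOMO, map_add, MOMO _ (MvPolynomial.X 1)]
  P0D0 := DOPO _ _
  P0D1 := DOPO _ _
  P1D0 := DOPO _ _
  P1D1 := DOPO _ _
  P0E0 z := by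
    simp only [EO0_apply, FOPO, map_add, POMO' 0 2 (by decide), POMO' 0 3 (by decide)]
  P0E1 z := by
    simp only [EO1_apply, FOPO, map_add, POMO' 0 2 (by decide), POMO' 0 3 (by decide)]
  P1E0 z := by
    simp only [EO0_apply, FOPO, map_add, POMO' 1 2 (by decide), POMO' 1 3 (by decide)]
  P1E1 z := by
    simp only [EO1_apply, FOPO, map_add, POMO' 1 2 (by decide), POMO' 1 3 (by decide)]
  Vinj := MO_inj 2

theorem sys_m : Sys (MO (MvPolynomial.X 3)) (DO 2) (DO 3) EO0 EO1
    (MO (MvPolynomial.X 0)) (MO (MvPolynomial.X 1)) (PO 0) (PO 1) :=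
  { sys_p with
    D0E0 := fun z => by simp [EO0_apply, DOMO, DOFO]; abel
    D1E1 := fun z => by simp [EO1_apply, DOMO, DOFO]; abel
    D0E1 := fun z => by simp [EO1_apply, DOMO, DOFO]; abel
    D1E0 := fun z => by simp [EO0_apply, DOMO, DOFO]; abel
    D00 := DODO _
    D11 := DODO _
    D10 := DODO' _ _
    VD0 := DOMO _ _
    VD1 := DOMO _ _
    VE0 := fun z => by
      simp only [EO0_apply, FOMO, map_add, MOMO (MvPolynomial.X 3) (MvPolynomial.X 2)]
    VE1 := fun z => by
      simp only [EO1_apply, FOMO, map_add, MOMO (MvPolynomial.X 3) (MvPolynomial.X 2)]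
    VU0 := MOMO _ _
    VU1 := MOMO _ _
    VP0 := POMO' _ _ (by decide)
    VP1 := POMO' _ _ (by decide)
    U0D0 := DOMO _ _
    U0D1 := DOMO _ _
    U1D0 := DOMO _ _
    U1D1 := DOMO _ _
    P0D0 := DOPO _ _
    P0D1 := DOPO _ _
    P1D0 := DOPO _ _
    P1D1 := DOPO _ _
    Vinj := MO_inj 3 }

def gen (q : MvPolynomial (Fin 2) ℂ) (r s : ℕ) : P4 :=
  MvPolynomial.rename uin q * MvPolynomial.X 2 ^ r * MvPolynomial.X 3 ^ s

theorem mem_GC {a b m n : ℤ} (r s d : ℕ) (ω : Ex) (q : MvPolynomial (Fin 2) ℂ) {k l : ℤ}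
    (hω : ω ∈ lamPM k l) (hk : k = a + r) (hl : l = b + s)
    (hq : q.IsHomogeneous d) (hd : (d : ℤ) = -m) (hn : (r : ℤ) + s = -n) :
    ω ⊗ₜ[ℂ] gen q r s ∈ GC a b m n := by
  subst hk hl
  exact Submodule.subset_span ⟨r, s, d, ω, q, hω, hq, hd, hn, rfl⟩

theorem gc_ind {a b m n : ℤ} (S : Submodule ℂ MEx) (T : MEx →ₗ[ℂ] MEx)
    (h : ∀ (r s d : ℕ) (ω : Ex) (q : MvPolynomial (Fin 2) ℂ), ω ∈ lamPM (a + r) (b + s) →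
      q.IsHomogeneous d → (d : ℤ) = -m → ((r : ℤ) + s = -n) → T (ω ⊗ₜ[ℂ] gen q r s) ∈ S)
    (z : MEx) (hz : z ∈ GC a b m n) : T z ∈ S := by
  have : GC a b m n ≤ S.comap T := by
    refine Submodule.span_le.mpr ?_
    rintro x ⟨r, s, d, ω, q, h1, h2, h3, h4, rfl⟩
    exact h r s d ω q h1 h2 h3 h4
  exact this hz

theorem gV1 (a b m n : ℤ) (z : MEx) (hz : z ∈ GC a b m n) :
    MO (MvPolynomial.X 2) z ∈ GC (a - 1) b m (n - 1) := by
  refine gc_ind _ _ ?_ z hz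
  intro r s d ω q h1 h2 h3 h4
  have e : (MvPolynomial.X 2 : P4) * gen q r s = gen q (r + 1) s := by simp only [gen]; ring
  rw [MO_t, e]
  exact mem_GC _ _ _ _ _ h1 (by push_cast; ring) rfl h2 h3 (by push_cast; linarith)

theorem gV2 (a b m n : ℤ) (z : MEx) (hz : z ∈ GC a b m n) :
    MO (MvPolynomial.X 3) z ∈ GC a (b - 1) m (n - 1) := by
  refine gc_ind _ _ ?_ z hz
  intro r s d ω q h1 h2 h3 h4
  have e : (MvPolynomial.X 3 : P4) * gen q r s = gen q r (s + 1) := by simp only [gen]; ring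
  rw [MO_t, e]
  exact mem_GC _ _ _ _ _ h1 rfl (by push_cast; ring) h2 h3 (by push_cast; linarith)

theorem gFp (i : Fin 2) (a b m n : ℤ) (z : MEx) (hz : z ∈ GC a b m n) :
    FO (uin i) z ∈ GC (a + 1) b m n := by
  refine gc_ind _ _ ?_ z hz
  intro r s d ω q h1 h2 h3 h4
  rw [FO_t]
  exact mem_GC _ _ _ _ _ (fp_mem i _ _ _ h1) (by ring) rfl h2 h3 h4

theorem gFm (i : Fin 2) (a b m n : ℤ) (z : MEx) (hz : z ∈ GC a b m n) :
    FO (win i) z ∈ GC a (b + 1) m n := by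
  refine gc_ind _ _ ?_ z hz
  intro r s d ω q h1 h2 h3 h4
  rw [FO_t]
  exact mem_GC _ _ _ _ _ (fm_mem i _ _ _ h1) rfl (by ring) h2 h3 h4

theorem gDp (i : Fin 2) (a b m n : ℤ) (z : MEx) (hz : z ∈ GC a b m n) :
    DO (uin i) z ∈ GC (a - 1) b m n := by
  refine gc_ind _ _ ?_ z hz
  intro r s d ω q h1 h2 h3 h4
  rw [DO_t]
  exact mem_GC _ _ _ _ _ (dp_mem i _ _ _ h1) (by ring) rfl h2 h3 h4

theorem gDm (i : Fin 2) (a b m n : ℤ) (z : MEx) (hz : z ∈ GC a b m n) :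
    DO (win i) z ∈ GC a (b - 1) m n := by
  refine gc_ind _ _ ?_ z hz
  intro r s d ω q h1 h2 h3 h4
  rw [DO_t]
  exact mem_GC _ _ _ _ _ (dm_mem i _ _ _ h1) rfl (by ring) h2 h3 h4

theorem gE0 (a b m n : ℤ) (z : MEx) (hz : z ∈ GC a b m n) : EO0 z ∈ GC a b m (n - 1) := by
  rw [EO0_apply]
  refine add_mem ?_ ?_
  · have := gV1 _ _ _ _ _ (gFp 0 _ _ _ _ _ hz)
    rwa [add_sub_cancel_right] at this
  · have := gV2 _ _ _ _ _ (gFm 0 _ _ _ _ _ hz)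
    rwa [add_sub_cancel_right] at this

theorem gE1 (a b m n : ℤ) (z : MEx) (hz : z ∈ GC a b m n) : EO1 z ∈ GC a b m (n - 1) := by
  rw [EO1_apply]
  refine add_mem ?_ ?_
  · have := gV1 _ _ _ _ _ (gFp 1 _ _ _ _ _ hz)
    rwa [add_sub_cancel_right] at this
  · have := gV2 _ _ _ _ _ (gFm 1 _ _ _ _ _ hz)
    rwa [add_sub_cancel_right] at this

theorem uin_inj : Function.Injective uin := by
  intro i j h
  have := congrArg Fin.val h
  exact Fin.ext this

theorem pd_gen (i : Fin 2) (q : MvPolynomial (Fin 2) ℂ) (r s : ℕ) :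
    MvPolynomial.pderiv (uin i) (gen q r s) = gen (MvPolynomial.pderiv i q) r s := by
  have h2 : MvPolynomial.pderiv (uin i) (MvPolynomial.X 2 : P4) = 0 :=
    MvPolynomial.pderiv_X_of_ne (fun h => uin_ne_win i 0 h.symm)
  have h3 : MvPolynomial.pderiv (uin i) (MvPolynomial.X 3 : P4) = 0 :=
    MvPolynomial.pderiv_X_of_ne (fun h => uin_ne_win i 1 h.symm)
  simp only [gen, Derivation.leibniz, Derivation.leibniz_pow, h2, h3,
    MvPolynomial.pderiv_rename uin_inj, smul_zero, zero_add, smul_eq_mul]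
  ring

theorem gP (i : Fin 2) (a b m n : ℤ) (z : MEx) (hz : z ∈ GC a b m n) :
    PO (uin i) z ∈ GC a b (m + 1) n := by
  refine gc_ind _ _ ?_ z hz
  intro r s d ω q h1 h2 h3 h4
  rw [PO_t, pd_gen]
  rcases d with _ | d
  · have : q = MvPolynomial.C (MvPolynomial.coeff 0 q) :=
      MvPolynomial.totalDegree_eq_zero_iff_eq_C.mp (Nat.le_zero.mp h2.totalDegree_le)
    rw [this, MvPolynomial.pderiv_C]
    simp [gen]
  · exact mem_GC _ _ _ _ _ h1 rfl rfl h2.pderiv (by push_cast at h3 ⊢; omega) h4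

theorem gEuler (a b m n : ℤ) (z : MEx) (hz : z ∈ GC a b m n) :
    MO (MvPolynomial.X 0) (PO 0 z) + MO (MvPolynomial.X 1) (PO 1 z) = (-(m : ℂ)) • z := by
  have : (MO (MvPolynomial.X 0) ∘ₗ PO 0 + MO (MvPolynomial.X 1) ∘ₗ PO 1
      - (-(m : ℂ)) • (LinearMap.id : MEx →ₗ[ℂ] MEx)) z ∈ (⊥ : Submodule ℂ MEx) := by
    refine gc_ind _ _ ?_ z hz
    intro r s d ω q h1 h2 h3 h4
    have e := congrArg (MvPolynomial.rename uin) h2.sum_X_mul_pderiv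
    have p0 := pd_gen 0 q r s
    have p1 := pd_gen 1 q r s
    rw [show uin 0 = 0 from rfl] at p0
    rw [show uin 1 = 1 from rfl] at p1
    simp only [Fin.sum_univ_two, map_add, map_mul, MvPolynomial.rename_X] at e
    rw [show uin 0 = 0 from rfl, show uin 1 = 1 from rfl] at e
    have hm : (-(m : ℂ)) = (d : ℂ) := by exact_mod_cast h3.symm
    rw [hm, Submodule.mem_bot]
    simp only [LinearMap.sub_apply, LinearMap.add_apply, LinearMap.comp_apply, LinearMap.smul_apply,
      LinearMap.id_apply, PO_t, MO_t, p0, p1, ← TensorProduct.tmul_add, ← TensorProduct.tmul_smul,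
      ← TensorProduct.tmul_sub]
    refine (congrArg (fun y : P4 => ω ⊗ₜ[ℂ] y) ?_).trans (TensorProduct.tmul_zero _ ω)
    rw [sub_eq_zero]
    simp only [gen, map_nsmul] at e ⊢
    rw [Nat.cast_smul_eq_nsmul, ← smul_mul_assoc, ← smul_mul_assoc, ← e]
    ring
  rw [Submodule.mem_bot] at this
  simpa [sub_eq_zero, add_eq_zero_iff_eq_neg] using this

theorem gOne (a b n : ℤ) : GC a b 1 n = ⊥ := by
  refine (Submodule.span_eq_bot).mpr ?_
  rintro x ⟨r, s, d, ω, q, h1, h2, h3, h4, rfl⟩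
  omega

theorem gDiv1 (a b m n : ℤ) (z : MEx) (ha : a ≤ 0) (hz : z ∈ GC (a - 1) b m (n - 1)) :
    ∃ y ∈ GC a b m n, MO (MvPolynomial.X 2) y = z := by
  have : (LinearMap.id : MEx →ₗ[ℂ] MEx) z ∈ (GC a b m n).map (MO (MvPolynomial.X 2)) := by
    refine gc_ind _ _ ?_ z hz
    intro r s d ω q h1 h2 h3 h4
    rcases lt_or_ge (a - 1 + r) 0 with h | h
    · rw [lam_neg1 _ _ h, Submodule.mem_bot] at h1
      subst h1
      simp
    · obtain ⟨r', rfl⟩ : ∃ r', r = r' + 1 := ⟨r - 1, by omega⟩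
      refine ⟨ω ⊗ₜ gen q r' s, ?_, ?_⟩
      · exact mem_GC _ _ _ _ _ h1 (by push_cast; ring) rfl h2 h3 (by push_cast at h4; linarith)
      · have e : (MvPolynomial.X 2 : P4) * gen q r' s = gen q (r' + 1) s := by
          simp only [gen]; ring
        rw [MO_t, e]; rfl
  exact this

theorem gDiv2 (a b m n : ℤ) (z : MEx) (hb : b ≤ 0) (hz : z ∈ GC a (b - 1) m (n - 1)) :
    ∃ y ∈ GC a b m n, MO (MvPolynomial.X 3) y = z := by
  have : (LinearMap.id : MEx →ₗ[ℂ] MEx) z ∈ (GC a b m n).map (MO (MvPolynomial.X 3)) := by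
    refine gc_ind _ _ ?_ z hz
    intro r s d ω q h1 h2 h3 h4
    rcases lt_or_ge (b - 1 + s) 0 with h | h
    · rw [lam_neg2 _ _ h, Submodule.mem_bot] at h1
      subst h1
      simp
    · obtain ⟨s', rfl⟩ : ∃ s', s = s' + 1 := ⟨s - 1, by omega⟩
      refine ⟨ω ⊗ₜ gen q r s', ?_, ?_⟩
      · exact mem_GC _ _ _ _ _ h1 rfl (by push_cast; ring) h2 h3 (by push_cast at h4; linarith)
      · have e : (MvPolynomial.X 3 : P4) * gen q r s' = gen q r (s' + 1) := by
          simp only [gen]; ring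
        rw [MO_t, e]; rfl
  exact this

theorem gr_p (b : ℤ) : Gr (MO (MvPolynomial.X 2)) (DO 0) (DO 1) EO0 EO1
    (MO (MvPolynomial.X 0)) (MO (MvPolynomial.X 1)) (PO 0) (PO 1) (fun a m n => GC a b m n) where
  GV a m n z := gV1 a b m n z
  GD0 a m n z := gDp 0 a b m n z
  GD1 a m n z := gDp 1 a b m n z
  GE0 a m n z := gE0 a b m n z
  GE1 a m n z := gE1 a b m n z
  GP0 a m n z := gP 0 a b m n z
  GP1 a m n z := gP 1 a b m n z
  div a m n z := gDiv1 a b m n z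
  euler a m n z := gEuler a b m n z
  G1 a n := gOne a b n

theorem gr_m (a : ℤ) : Gr (MO (MvPolynomial.X 3)) (DO 2) (DO 3) EO0 EO1
    (MO (MvPolynomial.X 0)) (MO (MvPolynomial.X 1)) (PO 0) (PO 1) (fun b m n => GC a b m n) where
  GV b m n z := gV2 a b m n z
  GD0 b m n z := gDm 0 a b m n z
  GD1 b m n z := gDm 1 a b m n z
  GE0 b m n z := gE0 a b m n z
  GE1 b m n z := gE1 a b m n z
  GP0 b m n z := gP 0 a b m n z
  GP1 b m n z := gP 1 a b m n z
  div b m n z := gDiv2 a b m n z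
  euler b m n z := gEuler a b m n z
  G1 b n := gOne a b n

def prO (i j : Fin 4) : MEx →ₗ[ℂ] MEx := DO i ∘ₗ FO i ∘ₗ DO j ∘ₗ FO j

theorem prO_t (i j : Fin 4) (x : Ex) (y : P4) : prO i j (x ⊗ₜ y) = (prj i j x) ⊗ₜ y := rfl

theorem prO_id (i j : Fin 4) (z : MEx) (hi : DO i z = 0) (hj : DO j z = 0) : prO i j z = z := by
  simp [prO, DOFO, hi, hj]

def iX (p : P4) : Ex →ₗ[ℂ] MEx := (TensorProduct.mk ℂ Ex P4).flip p

theorem iX_apply (p : P4) (x : Ex) : iX p x = x ⊗ₜ p := rfl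

theorem gen_const (q : MvPolynomial (Fin 2) ℂ) (hq : q.IsHomogeneous 0) (r s : ℕ) :
    gen q r s = (MvPolynomial.coeff 0 q) • gen 1 r s := by
  have : q = MvPolynomial.C (MvPolynomial.coeff 0 q) :=
      MvPolynomial.totalDegree_eq_zero_iff_eq_C.mp (Nat.le_zero.mp hq.totalDegree_le)
  conv_lhs => rw [this]
  simp only [gen, MvPolynomial.rename_C, map_one, MvPolynomial.smul_eq_C_mul]
  ring

theorem W_p (a b N : ℤ) (S : Submodule ℂ MEx)
    (hS : ∀ r s : ℕ, a + r = 0 → (r : ℤ) + s = -N → ∀ ω ∈ lamPM 0 (b + s), iX (gen 1 r s) ω ∈ S)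
    (w : MEx) (hw : w ∈ GC a b 0 N) (h0 : DO 0 w = 0) (h1 : DO 1 w = 0) : w ∈ S := by
  rw [← prO_id 0 1 w h0 h1]
  refine gc_ind _ _ ?_ w hw
  intro r s d ω q h1 h2 h3 h4
  have hd : d = 0 := by omega
  subst hd
  rw [prO_t]
  by_cases h : a + r = 0
  · rw [h] at h1
    rw [prj_id 0 1 _ (dp_zero 0 _ _ h1) (dp_zero 1 _ _ h1), gen_const q h2, TensorProduct.tmul_smul]
    exact Submodule.smul_mem _ _ (hS r s h h4 ω h1)
  · rw [prj_p _ _ h ω h1, TensorProduct.zero_tmul]; exact zero_mem _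

theorem W_m (a b N : ℤ) (S : Submodule ℂ MEx)
    (hS : ∀ r s : ℕ, b + s = 0 → (r : ℤ) + s = -N → ∀ ω ∈ lamPM (a + r) 0, iX (gen 1 r s) ω ∈ S)
    (w : MEx) (hw : w ∈ GC a b 0 N) (h0 : DO 2 w = 0) (h1 : DO 3 w = 0) : w ∈ S := by
  rw [← prO_id 2 3 w h0 h1]
  refine gc_ind _ _ ?_ w hw
  intro r s d ω q h1 h2 h3 h4
  have hd : d = 0 := by omega
  subst hd
  rw [prO_t]
  by_cases h : b + s = 0
  · rw [h] at h1
    rw [prj_id 2 3 _ (dm_zero 0 _ _ h1) (dm_zero 1 _ _ h1), gen_const q h2, TensorProduct.tmul_smul]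
    exact Submodule.smul_mem _ _ (hS r s h h4 ω h1)
  · rw [prj_m _ _ h ω h1, TensorProduct.zero_tmul]; exact zero_mem _

theorem iX_inj (r s : ℕ) (ω : Ex) (h : iX (gen 1 r s) ω = 0) : ω = 0 := by
  let φ : P4 →ₗ[ℂ] ℂ := (MvPolynomial.aeval (fun _ : Fin 4 => (1 : ℂ))).toLinearMap
  have e := congrArg (fun z => TensorProduct.rid ℂ Ex (LinearMap.lTensor Ex φ z)) h
  simpa [iX_apply, φ, gen] using e

theorem core_all {D0 D1 V E0 E1 U0 U1 P0 P1 : MEx →ₗ[ℂ] MEx} {G : ℤ → ℤ → ℤ → Submodule ℂ MEx}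
    (S : Sys V D0 D1 E0 E1 U0 U1 P0 P1) (T : Gr V D0 D1 E0 E1 U0 U1 P0 P1 G)
    (hN : ∀ z, nabla z = U0 (E0 z) + U1 (E1 z))
    (a m n : ℤ) (ha : a < 0) (k : ℕ)
    (hW0 : a < n + 2 → ∀ w ∈ G a 0 (n + 2), D0 w = 0 → D1 w = 0 → w = 0)
    (hE : n + 2 ≤ a → ∃ (X : Submodule ℂ Ex) (r s : ℕ),
      Nonempty (X ≃ₗ[ℂ] (Fin k → ℂ)) ∧
      (∀ x ∈ X, iX (gen 1 r s) x ∈ G a 0 (n + 2) ∧ D0 (iX (gen 1 r s) x) = 0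
        ∧ D1 (iX (gen 1 r s) x) = 0) ∧
      (∀ w ∈ G a 0 (n + 2), D0 w = 0 → D1 w = 0 → w ∈ X.map (iX (gen 1 r s)))) :
    (m < 0 → G a m n ⊓ LinearMap.ker nabla ≤ Submodule.map nabla (G a (m + 1) (n + 1))) ∧
    (m = 0 → a - 2 < n →
      G a m n ⊓ LinearMap.ker nabla ≤ Submodule.map nabla (G a (m + 1) (n + 1))) ∧
    (m = 0 → n ≤ a - 2 →
      Nonempty ((↥(G a m n ⊓ LinearMap.ker nabla) ⧸
          (Submodule.comap (G a m n ⊓ LinearMap.ker nabla).subtype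
            (Submodule.map nabla (G a (m + 1) (n + 1))))) ≃ₗ[ℂ] (Fin k → ℂ))) := by
  refine ⟨?_, ?_, ?_⟩
  · rintro hm z ⟨hz, hk⟩
    rw [SetLike.mem_coe, LinearMap.mem_ker, hN] at hk
    obtain ⟨y, hy, e⟩ := core_exact S T a m n ha hm z hz hk
    exact ⟨y, hy, by rw [hN, e]⟩
  · rintro rfl hn z ⟨hz, hk⟩
    rw [SetLike.mem_coe, LinearMap.mem_ker, hN] at hk
    obtain ⟨w, hw, h0, h1, e⟩ := core_ker S T a n ha z hz hk
    have := hW0 (by omega) w hw h0 h1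
    rw [e, this]; simp
  · rintro rfl hn
    obtain ⟨X, r, s, ⟨eX⟩, hX, hW⟩ := hE (by omega)
    obtain ⟨e⟩ := core_equiv S T nabla hN a n ha ((iX (gen 1 r s)) ∘ₗ X.subtype)
      (fun x hx => Subtype.ext (iX_inj r s x.1 hx)) (fun x => hX x.1 x.2)
      (fun w hw h0 h1 => by
        obtain ⟨x, hx, rfl⟩ := hW w hw h0 h1
        exact ⟨⟨x, hx⟩, rfl⟩)
    have hb : Submodule.comap (G a 0 n ⊓ LinearMap.ker nabla).subtype
            (Submodule.map nabla (G a (0 + 1) (n + 1))) = ⊥ := by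
      rw [zero_add, T.G1, Submodule.map_bot, Submodule.comap_bot, Submodule.ker_subtype]
    exact ⟨(Submodule.quotEquivOfEqBot _ hb).trans (e.symm.trans eX)⟩


/-- for integers `a, b` with `a < 0` or `b < 0` and `k = min a b`:
`H^{m,n}(G_C(a,b)) = 0` whenever `m < 0`, or `m = 0` and `n > k−2`; and for `m = 0`,
`n ≤ k−2`, `H^{0,n}(G_C(a,b))` is a `ℂ`-vector space of dimension `binom(2, a+b−n−2)`. -/
theorem homology_GC (a b m n : ℤ) (hab : a < 0 ∨ b < 0) :
    (m < 0 →
      GC a b m n ⊓ LinearMap.ker nabla ≤ Submodule.map nabla (GC a b (m + 1) (n + 1))) ∧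
    (m = 0 → min a b - 2 < n →
      GC a b m n ⊓ LinearMap.ker nabla ≤ Submodule.map nabla (GC a b (m + 1) (n + 1))) ∧
    (m = 0 → n ≤ min a b - 2 →
      Nonempty ((↥(GC a b m n ⊓ LinearMap.ker nabla) ⧸
          (Submodule.comap (GC a b m n ⊓ LinearMap.ker nabla).subtype
            (Submodule.map nabla (GC a b (m + 1) (n + 1))))) ≃ₗ[ℂ]
        (Fin (zbinom (a + b - n - 2)) → ℂ))) := by
  rcases le_total a b with h | h
  · have ha : a < 0 := by omega
    rw [min_eq_left h]
    refine core_all sys_p (gr_p b) nabla_eq a m n ha _ ?_ ?_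
    · intro hn w hw h0 h1
      have := W_p a b (n + 2) ⊥ (fun r s h1 h2 => by omega) w hw h0 h1
      simpa using this
    · intro hn
      obtain ⟨r, hr⟩ := Int.eq_ofNat_of_zero_le (show 0 ≤ -a by omega)
      obtain ⟨s, hs⟩ := Int.eq_ofNat_of_zero_le (show 0 ≤ a - (n + 2) by omega)
      refine ⟨lamPM 0 (b + s), r, s, ?_, ?_, ?_⟩
      · rw [lam_m, show a + b - n - 2 = b + s by omega]
        exact lamC_equiv win (by decide) _
      · intro x hx
        refine ⟨mem_GC r s 0 x 1 hx (by omega) rfl (MvPolynomial.isHomogeneous_one _ _) (by simp)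
          (by omega), ?_, ?_⟩
        · rw [iX_apply, DO_t, show dd 0 x = 0 from dp_zero 0 _ _ hx, TensorProduct.zero_tmul]
        · rw [iX_apply, DO_t, show dd 1 x = 0 from dp_zero 1 _ _ hx, TensorProduct.zero_tmul]
      · intro w hw h0 h1
        refine W_p a b (n + 2) _ ?_ w hw h0 h1
        intro r' s' h1 h2 ω hω
        obtain rfl : r' = r := by omega
        obtain rfl : s' = s := by omega
        exact ⟨ω, hω, rfl⟩
  · have hb : b < 0 := by omega
    rw [min_eq_right h]
    refine core_all sys_m (gr_m a) nabla_eq b m n hb _ ?_ ?_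
    · intro hn w hw h0 h1
      have := W_m a b (n + 2) ⊥ (fun r s h1 h2 => by omega) w hw h0 h1
      simpa using this
    · intro hn
      obtain ⟨s, hs⟩ := Int.eq_ofNat_of_zero_le (show 0 ≤ -b by omega)
      obtain ⟨r, hr⟩ := Int.eq_ofNat_of_zero_le (show 0 ≤ b - (n + 2) by omega)
      refine ⟨lamPM (a + r) 0, r, s, ?_, ?_, ?_⟩
      · rw [lam_p, show a + b - n - 2 = a + r by omega]
        exact lamC_equiv uin (by decide) _
      · intro x hx
        refine ⟨mem_GC r s 0 x 1 hx rfl (by omega) (MvPolynomial.isHomogeneous_one _ _) (by simp)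
          (by omega), ?_, ?_⟩
        · rw [iX_apply, DO_t, show dd 2 x = 0 from dm_zero 0 _ _ hx, TensorProduct.zero_tmul]
        · rw [iX_apply, DO_t, show dd 3 x = 0 from dm_zero 1 _ _ hx, TensorProduct.zero_tmul]
      · intro w hw h0 h1
        refine W_m a b (n + 2) _ ?_ w hw h0 h1
        intro r' s' h1 h2 ω hω
        obtain rfl : s' = s := by omega
        obtain rfl : r' = r := by omega
        exact ⟨ω, hω, rfl⟩

end
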